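/- arXiv:2405.09207 — 2 statements merged into one kernel-verified Lean document; each statement's English description precedes it below -/
import Mathlib

section
/- Let Σ ∈ ℝ^{n×n} be symmetric positive definite with eigenvalues κ₁ ≥ κ₂ ≥ … ≥ κ_n > 0 (with multiplicity), and let W ∈ ℝ^{k×n} (1 ≤ k ≤ n) have full row rank with singular values s_{W,1} ≥ … ≥ s_{W,k} > 0. Then det(W Σ Wᵀ) ≥ ∏_{i=1}^{k} s_{W,i}² · κ_{n−i+1}. -/
open Matrix BigOperators

/-- A Cauchy–Binet type expansion, summed over all maps instead of over subsets. -/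
theorem factorial_mul_det_mul_diagonal_mul_transpose {R m n : Type*} [CommRing R]
    [Fintype m] [DecidableEq m] [Fintype n] [DecidableEq n]
    (Y : Matrix m n R) (d : n → R) :
    ((Fintype.card m).factorial : R) * (Y * diagonal d * Yᵀ).det =
      ∑ f : m → n, (∏ i, d (f i)) * (Y.submatrix id f).det ^ 2 := by
  have expand : (Y * diagonal d * Yᵀ).det =
      ∑ f : m → n, (∏ i, d (f i)) * (∏ i, Y i (f i)) * (Y.submatrix id f).det := by
    have rows : Y * diagonal d * Yᵀ = fun i => ∑ j, (Y i j * d j) • Yᵀ j := by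
      ext i l
      rw [Matrix.mul_apply]
      simp [mul_diagonal]
    rw [rows]
    change detRowAlternating.toMultilinearMap (fun i => ∑ j, (Y i j * d j) • Yᵀ j) = _
    rw [MultilinearMap.map_sum]
    refine Finset.sum_congr rfl fun f _ => ?_
    rw [MultilinearMap.map_smul_univ, ← det_transpose (Y.submatrix id f), smul_eq_mul,
      Finset.prod_mul_distrib, mul_comm (∏ i, Y i (f i))]
    rfl
  have permute (σ : Equiv.Perm m) : (Y * diagonal d * Yᵀ).det =
      ∑ f : m → n, (∏ i, d (f i)) * (Y.submatrix id f).det *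
        ((Equiv.Perm.sign σ : ℤ) * ∏ i, Y i (f (σ i))) := by
    rw [expand, ← Equiv.sum_comp (Equiv.arrowCongr σ.symm (Equiv.refl n))]
    refine Finset.sum_congr rfl fun f _ => ?_
    have hd : ∏ i, d (f (σ i)) = ∏ i, d (f i) := Equiv.prod_comp σ fun i => d (f i)
    have hdet : (Y.submatrix id (f ∘ σ)).det =
        (Equiv.Perm.sign σ : ℤ) * (Y.submatrix id f).det :=
      det_permute' σ (Y.submatrix id f)
    change (∏ i, d (f (σ i))) * (∏ i, Y i (f (σ i))) * (Y.submatrix id (f ∘ σ)).det = _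
    rw [hd, hdet]
    ring
  calc ((Fintype.card m).factorial : R) * (Y * diagonal d * Yᵀ).det
      = ∑ _σ : Equiv.Perm m, (Y * diagonal d * Yᵀ).det := by
        simp [Fintype.card_perm]
    _ = ∑ σ : Equiv.Perm m, ∑ f : m → n, (∏ i, d (f i)) * (Y.submatrix id f).det *
          ((Equiv.Perm.sign σ : ℤ) * ∏ i, Y i (f (σ i))) :=
        Finset.sum_congr rfl fun σ _ => permute σ
    _ = _ := by
        rw [Finset.sum_comm]
        refine Finset.sum_congr rfl fun f _ => ?_
        rw [← Finset.mul_sum, pow_two, ← mul_assoc]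
        congr 1
        rw [← det_transpose, det_apply']
        rfl

theorem Fin.val_le_of_strictMono {k : ℕ} {g : Fin k → ℕ} (hg : StrictMono g) (i : Fin k) :
    (i : ℕ) ≤ g i := by
  obtain ⟨i, hi⟩ := i
  induction i with
  | zero => exact Nat.zero_le _
  | succ j ih =>
    have hj : j < k := by omega
    have hlt : g ⟨j, hj⟩ < g ⟨j + 1, hi⟩ := hg (by simp [Fin.lt_def])
    have := ih hj
    simp only at this ⊢
    omega

/-- The product of the last `k` values of a positive antitone sequence is the smallest product of
`k` values at distinct indices. -/
theorem prod_last_le_prod_of_injective {n k : ℕ} {d : Fin n → ℝ} (hpos : ∀ i, 0 < d i)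
    (hd : Antitone d) {f : Fin k → Fin n} (hf : Function.Injective f)
    (h : ∀ i : Fin k, n - 1 - (i : ℕ) < n) :
    ∏ i : Fin k, d ⟨n - 1 - (i : ℕ), h i⟩ ≤ ∏ i, d (f i) := by
  have hcard : (Finset.univ.image f).card = k := by
    rw [Finset.card_image_of_injective _ hf, Finset.card_univ, Fintype.card_fin]
  let e := (Finset.univ.image f).orderEmbOfFin hcard
  have hprod : ∏ i, d (f i) = ∏ i : Fin k, d (e (Fin.rev i)) := by
    have hrev : ∏ i : Fin k, d (e (Fin.rev i)) = ∏ i, d (e i) :=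
      Equiv.prod_comp Fin.revPerm fun i => d (e i)
    rw [hrev, ← Finset.prod_image (s := Finset.univ) (g := f) (f := d) hf.injOn,
      ← Finset.prod_image (s := Finset.univ) (g := e) (f := d) e.injective.injOn,
      Finset.image_orderEmbOfFin_univ]
  rw [hprod]
  refine Finset.prod_le_prod (fun i _ => (hpos _).le) fun i _ => hd ?_
  have hg : StrictMono fun i : Fin k => n - 1 - (e (Fin.rev i) : ℕ) := by
    intro a b hab
    have hlt : e (Fin.rev b) < e (Fin.rev a) := e.strictMono (Fin.rev_lt_rev.2 hab)
    have := (e (Fin.rev a)).isLt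
    simp only [Fin.lt_def] at hlt ⊢
    omega
  have := Fin.val_le_of_strictMono hg i
  have := (e (Fin.rev i)).isLt
  simp only [Fin.le_def] at *
  omega

/-- `det (Y D Yᵀ)` is at least `det (Y Yᵀ)` times the product of the `k` smallest entries of the
positive diagonal matrix `D`. -/
theorem prod_last_mul_det_le_det_mul_diagonal_mul_transpose {n k : ℕ} {d : Fin n → ℝ}
    (hpos : ∀ i, 0 < d i) (hd : Antitone d) (Y : Matrix (Fin k) (Fin n) ℝ)
    (h : ∀ i : Fin k, n - 1 - (i : ℕ) < n) :
    (∏ i : Fin k, d ⟨n - 1 - (i : ℕ), h i⟩) * (Y * Yᵀ).det ≤ (Y * diagonal d * Yᵀ).det := by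
  have hfac : (0 : ℝ) < ((Fintype.card (Fin k)).factorial : ℝ) := by positivity
  refine le_of_mul_le_mul_left ?_ hfac
  have hone := factorial_mul_det_mul_diagonal_mul_transpose Y fun _ => (1 : ℝ)
  rw [diagonal_one, Matrix.mul_one] at hone
  rw [mul_left_comm, hone, factorial_mul_det_mul_diagonal_mul_transpose, Finset.mul_sum]
  refine Finset.sum_le_sum fun f _ => ?_
  rw [Finset.prod_const_one, one_mul]
  by_cases hf : Function.Injective f
  · exact mul_le_mul_of_nonneg_right (prod_last_le_prod_of_injective hpos hd hf h) (sq_nonneg _)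
  · obtain ⟨a, b, hab, hne⟩ := Function.not_injective_iff.1 hf
    have hzero : (Y.submatrix id f).det = 0 :=
      det_zero_of_column_eq hne fun i => by simp [hab]
    simp [hzero]

/-- let `Σ = V K Vᵀ` be symmetric positive definite with
eigenvalues `κ₁ ≥ … ≥ κ_n > 0` (with multiplicity, `V` orthogonal), and let
`W ∈ ℝ^{k×n}` have full row rank with singular values
`s_{W,1} ≥ … ≥ s_{W,k} > 0` (so `W Wᵀ = U diag(s²) Uᵀ` for some orthogonal `U`).
Then `det(W Σ Wᵀ) ≥ ∏_{i=1}^{k} s_{W,i}² κ_{n−i+1}`. -/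
theorem stmt5 {n k : ℕ} (hk : 1 ≤ k) (hkn : k ≤ n)
    (Sg V : Matrix (Fin n) (Fin n) ℝ) (kap : Fin n → ℝ)
    (hV : V * Vᵀ = 1) (hSg : Sg = V * Matrix.diagonal kap * Vᵀ)
    (hkpos : ∀ i, 0 < kap i)
    (hksort : ∀ i j : Fin n, i ≤ j → kap j ≤ kap i)
    (W : Matrix (Fin k) (Fin n) ℝ)
    (s : Fin k → ℝ) (hspos : ∀ i, 0 < s i)
    (hssort : ∀ i j : Fin k, i ≤ j → s j ≤ s i)
    (U : Matrix (Fin k) (Fin k) ℝ) (hU : U * Uᵀ = 1)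
    (hWWt : W * Wᵀ = U * Matrix.diagonal (fun i => s i ^ 2) * Uᵀ) :
    (∏ i : Fin k, s i ^ 2 * kap ⟨n - 1 - (i : ℕ), by have := i.isLt; omega⟩) ≤
      (W * Sg * Wᵀ).det := by
  have hdet : (W * Wᵀ).det = ∏ i, s i ^ 2 := by
    rw [hWWt, det_mul_right_comm, hU, Matrix.one_mul, det_diagonal]
  have hYY : W * V * (W * V)ᵀ = W * Wᵀ := by
    rw [transpose_mul, Matrix.mul_assoc, ← Matrix.mul_assoc V, hV, Matrix.one_mul]
  have hYKY : W * Sg * Wᵀ = W * V * diagonal kap * (W * V)ᵀ := by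
    simp only [hSg, transpose_mul, Matrix.mul_assoc]
  rw [Finset.prod_mul_distrib, hYKY, mul_comm, ← hdet, ← hYY]
  exact prod_last_mul_det_le_det_mul_diagonal_mul_transpose hkpos
    (fun i j hij => hksort i j hij) (W * V) _
end

section
/- Let A ∈ ℝ^{n×n} be symmetric with det A ≠ 0 and eigenvalues λ₁, …, λ_n (with multiplicity) ordered so that |λ₁| ≥ … ≥ |λ_n| > 0, let Σ ∈ ℝ^{n×n} be symmetric positive definite, let η ≥ 0, and let W ∈ ℝ^{k×n} (1 ≤ k ≤ n) have full row rank with det(W A W†) ≠ 0 and satisfy the constraint det(W Σ Wᵀ)^{1/k} ≥ e^{−2η} · det(Σ)^{1/n}. Then Δ𝒥(W) = ln(|det(W A W†)|^{1/k}/|det A|^{1/n}) + ln((det Σ)^{1/(2n)}/(det(W Σ Wᵀ))^{1/(2k)}) ≤ (1/k)·Σ_{i=1}^{k} ln|λ_i| − (1/n)·Σ_{i=1}^{n} ln|λ_i| + η. -/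
open Matrix BigOperators

/-- The causal emergence of the coarse-graining `W` applied to the linear
stochastic iteration system `x_{t+1} = A x_t + ε_t`, `ε_t ~ N(0, Σ)`:
`Δ𝒥(W) = ln(|det(WAW†)|^{1/k}/|det A|^{1/n}) + ln((det Σ)^{1/2n}/(det(WΣWᵀ))^{1/2k})`
where `W† = Wᵀ(WWᵀ)⁻¹`. -/
noncomputable def deltaJ {n k : ℕ} (A Sg : Matrix (Fin n) (Fin n) ℝ)
    (W : Matrix (Fin k) (Fin n) ℝ) : ℝ :=
  Real.log (|(W * A * (Wᵀ * (W * Wᵀ)⁻¹)).det| ^ ((1 : ℝ) / k) / |A.det| ^ ((1 : ℝ) / n)) +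
  Real.log (Sg.det ^ (1 / (2 * (n : ℝ))) / (W * Sg * Wᵀ).det ^ (1 / (2 * (k : ℝ))))

/-- A symmetrized Cauchy–Binet formula: the minors are summed over all column selections. -/
theorem factorial_mul_det_mul_diagonal_mul_transpose_s7 {n k : ℕ} (M : Matrix (Fin k) (Fin n) ℝ)
    (d : Fin n → ℝ) :
    (k.factorial : ℝ) * (M * Matrix.diagonal d * Mᵀ).det =
      ∑ f : Fin k → Fin n, (∏ i, d (f i)) * (M.submatrix id f).det ^ 2 := by
  have expand : (M * Matrix.diagonal d * Mᵀ).det =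
      ∑ f : Fin k → Fin n, (∏ i, d (f i)) * (∏ i, M i (f i)) * (M.submatrix id f).det := by
    have rows : M * Matrix.diagonal d * Mᵀ =
        fun i => ∑ j : Fin n, (M i j * d j) • (fun l => M l j) := by
      ext i l
      simp [Matrix.mul_apply, Finset.sum_apply, Matrix.diagonal_apply]
    change Matrix.detRowAlternating (M * Matrix.diagonal d * Mᵀ) = _
    rw [rows]
    have h := (Matrix.detRowAlternating (n := Fin k) (R := ℝ)).toMultilinearMap.map_sum
      (fun i (j : Fin n) => (M i j * d j) • (fun l => M l j))
    refine h.trans (Finset.sum_congr rfl fun f _ => ?_)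
    rw [MultilinearMap.map_smul_univ, Finset.prod_mul_distrib, smul_eq_mul,
      mul_comm (∏ i, M i (f i)), ← Matrix.det_transpose (M.submatrix id f)]
    rfl
  have perm (σ : Equiv.Perm (Fin k)) : (M * Matrix.diagonal d * Mᵀ).det =
      ∑ f : Fin k → Fin n, (∏ i, d (f i)) *
        ((Equiv.Perm.sign σ : ℝ) * ∏ i, M i (f (σ i))) * (M.submatrix id f).det := by
    rw [expand, ← (σ.arrowCongr (Equiv.refl (Fin n))).symm.sum_comp]
    refine Finset.sum_congr rfl fun f _ => ?_
    have h1 : (σ.arrowCongr (Equiv.refl (Fin n))).symm f = f ∘ σ := rfl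
    have h2 : (M.submatrix id (f ∘ σ)).det =
        (Equiv.Perm.sign σ : ℝ) * (M.submatrix id f).det := by
      simpa using Matrix.det_permute' σ (M.submatrix id f)
    rw [h1, h2]
    simp only [Function.comp_apply]
    rw [Equiv.prod_comp σ (fun i => d (f i))]
    ring
  have total : (k.factorial : ℝ) * (M * Matrix.diagonal d * Mᵀ).det =
      ∑ _σ : Equiv.Perm (Fin k), (M * Matrix.diagonal d * Mᵀ).det := by
    simp [Fintype.card_perm]
  rw [total, Finset.sum_congr rfl fun σ _ => perm σ, Finset.sum_comm]
  refine Finset.sum_congr rfl fun f _ => ?_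
  rw [← Finset.sum_mul, ← Finset.mul_sum, sq, ← mul_assoc]
  congr 2
  rw [← Matrix.det_transpose, Matrix.det_apply']
  rfl

theorem prod_le_prod_castLE_of_antitone {n k : ℕ} (hkn : k ≤ n) {a : Fin n → ℝ}
    (ha : ∀ i, 0 ≤ a i) (hanti : Antitone a) {f : Fin k → Fin n} (hf : Function.Injective f) :
    ∏ i, a (f i) ≤ ∏ i : Fin k, a (Fin.castLE hkn i) := by
  set s := Finset.univ.image f with hs
  have hcard : s.card = k := by simp [hs, Finset.card_image_of_injective _ hf]
  have hle (m : ℕ) (hm : m < k) : m ≤ (s.orderEmbOfFin hcard ⟨m, hm⟩ : ℕ) := by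
    induction m with
    | zero => exact Nat.zero_le _
    | succ m ih =>
      have hlt : s.orderEmbOfFin hcard ⟨m, by omega⟩ < s.orderEmbOfFin hcard ⟨m + 1, hm⟩ :=
        (s.orderEmbOfFin hcard).strictMono (by simp)
      have := ih (by omega)
      have := Fin.lt_def.mp hlt
      omega
  calc ∏ i, a (f i) = ∏ j ∈ s, a j := (Finset.prod_image fun _ _ _ _ h => hf h).symm
    _ = ∏ i, a (s.orderEmbOfFin hcard i) := by
        conv_lhs => rw [← Finset.image_orderEmbOfFin_univ s hcard]
        exact Finset.prod_image fun _ _ _ _ h => (s.orderEmbOfFin hcard).injective h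
    _ ≤ ∏ i : Fin k, a (Fin.castLE hkn i) :=
        Finset.prod_le_prod (fun _ _ => ha _) fun i _ => hanti (Fin.le_def.mpr (hle i i.2))

theorem abs_det_mul_diagonal_mul_transpose_le {n k : ℕ} (hkn : k ≤ n)
    (M : Matrix (Fin k) (Fin n) ℝ) {d : Fin n → ℝ} (hd : Antitone fun i => |d i|) :
    |(M * Matrix.diagonal d * Mᵀ).det| ≤
      (∏ i : Fin k, |d (Fin.castLE hkn i)|) * (M * Mᵀ).det := by
  have hpos : (0 : ℝ) < k.factorial := by exact_mod_cast k.factorial_pos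
  refine le_of_mul_le_mul_left ?_ hpos
  have hone := factorial_mul_det_mul_diagonal_mul_transpose_s7 M (fun _ => 1)
  simp only [Matrix.diagonal_one, Matrix.mul_one, Finset.prod_const_one, one_mul] at hone
  rw [mul_left_comm, hone, Finset.mul_sum, ← abs_of_pos hpos, ← abs_mul,
    factorial_mul_det_mul_diagonal_mul_transpose_s7]
  refine (Finset.abs_sum_le_sum_abs _ _).trans (Finset.sum_le_sum fun f _ => ?_)
  rw [abs_mul, abs_of_nonneg (sq_nonneg (M.submatrix id f).det), Finset.abs_prod]
  by_cases hf : Function.Injective f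
  · exact mul_le_mul_of_nonneg_right
      (prod_le_prod_castLE_of_antitone hkn (fun i => abs_nonneg (d i)) hd hf) (sq_nonneg _)
  · obtain ⟨i, j, hij, hne⟩ : ∃ i j, f i = f j ∧ i ≠ j := by
      simpa [Function.Injective] using hf
    have hdet : (M.submatrix id f).det = 0 :=
      Matrix.det_zero_of_column_eq hne fun l => by simp [hij]
    simp [hdet]

theorem det_mul_transpose_self_nonneg {n k : ℕ} (W : Matrix (Fin k) (Fin n) ℝ) :
    0 ≤ (W * Wᵀ).det := by
  simpa using (Matrix.posSemidef_self_mul_conjTranspose W).det_nonneg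

/-- The compression bound `|det (W A W†)| ≤ |λ₁| ⋯ |λ_k|`. -/
theorem abs_det_mul_pseudoinverse_le {n k : ℕ} (hkn : k ≤ n)
    {V : Matrix (Fin n) (Fin n) ℝ} {lam : Fin n → ℝ} (hV : V * Vᵀ = 1)
    (hanti : Antitone fun i => |lam i|)
    {W : Matrix (Fin k) (Fin n) ℝ} (hW : IsUnit (W * Wᵀ)) :
    |(W * (V * Matrix.diagonal lam * Vᵀ) * (Wᵀ * (W * Wᵀ)⁻¹)).det| ≤
      ∏ i : Fin k, |lam (Fin.castLE hkn i)| := by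
  have hpos : 0 < (W * Wᵀ).det :=
    lt_of_le_of_ne (det_mul_transpose_self_nonneg W)
      ((Matrix.isUnit_iff_isUnit_det _).mp hW).ne_zero.symm
  have hle := abs_det_mul_diagonal_mul_transpose_le hkn (W * V) hanti
  have hgram : W * V * (W * V)ᵀ = W * Wᵀ := by
    rw [Matrix.transpose_mul, Matrix.mul_assoc, ← Matrix.mul_assoc V, hV, Matrix.one_mul]
  rw [hgram] at hle
  have hfact : W * (V * Matrix.diagonal lam * Vᵀ) * (Wᵀ * (W * Wᵀ)⁻¹) =
      W * V * Matrix.diagonal lam * (W * V)ᵀ * (W * Wᵀ)⁻¹ := by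
    simp only [Matrix.transpose_mul, Matrix.mul_assoc]
  rw [hfact, Matrix.det_mul, Matrix.det_nonsing_inv, Ring.inverse_eq_inv', abs_mul, abs_inv,
    abs_of_pos hpos, ← div_eq_mul_inv]
  exact (div_le_iff₀ hpos).mpr hle

theorem abs_det_orthogonal_conj_diagonal {n : ℕ} {V : Matrix (Fin n) (Fin n) ℝ} (lam : Fin n → ℝ)
    (hV : V * Vᵀ = 1) : |(V * Matrix.diagonal lam * Vᵀ).det| = ∏ i, |lam i| := by
  rw [Matrix.det_mul_right_comm, hV, Matrix.one_mul, Matrix.det_diagonal, Finset.abs_prod]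

theorem prod_castLE_eq_prod_filter {n k : ℕ} (hkn : k ≤ n) (a : Fin n → ℝ) :
    ∏ i : Fin k, a (Fin.castLE hkn i) =
      ∏ i ∈ Finset.univ.filter (fun i : Fin n => (i : ℕ) < k), a i := by
  refine Finset.prod_bij (fun i _ => Fin.castLE hkn i) ?_ ?_ ?_ ?_
  · intro i _; simp
  · intro i _ j _ h; exact Fin.castLE_injective hkn h
  · intro j hj
    exact ⟨⟨j, (Finset.mem_filter.mp hj).2⟩, Finset.mem_univ _, rfl⟩
  · intro i _; rfl

/-- for symmetric `A = V Λ Vᵀ` (`V` orthogonal) with nonzero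
eigenvalues sorted as `|λ₁| ≥ … ≥ |λ_n| > 0`, `Σ` symmetric positive definite,
`η ≥ 0`, and any full-row-rank `W ∈ ℝ^{k×n}` with `det(WAW†) ≠ 0` obeying the
constraint `det(WΣWᵀ)^{1/k} ≥ e^{−2η} (det Σ)^{1/n}`,
`Δ𝒥(W) ≤ (1/k)·Σ_{i≤k} ln|λ_i| − (1/n)·Σ_{i≤n} ln|λ_i| + η`. -/
theorem stmt7 {n k : ℕ} (hk : 1 ≤ k) (hkn : k ≤ n)
    (A V : Matrix (Fin n) (Fin n) ℝ) (lam : Fin n → ℝ)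
    (hV : V * Vᵀ = 1) (hA : A = V * Matrix.diagonal lam * Vᵀ)
    (hlam : ∀ i, lam i ≠ 0)
    (hsort : ∀ i j : Fin n, i ≤ j → |lam j| ≤ |lam i|)
    (hAdet : A.det ≠ 0)
    (Sg : Matrix (Fin n) (Fin n) ℝ) (hSg : Sg.PosDef)
    (η : ℝ) (hη : 0 ≤ η)
    (W : Matrix (Fin k) (Fin n) ℝ) (hW : IsUnit (W * Wᵀ))
    (hAM : (W * A * (Wᵀ * (W * Wᵀ)⁻¹)).det ≠ 0)
    (hconstraint : (W * Sg * Wᵀ).det ^ (1 / (k : ℝ)) ≥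
      Real.exp (-(2 * η)) * Sg.det ^ (1 / (n : ℝ))) :
    deltaJ A Sg W ≤
      (1 / (k : ℝ)) * (∑ i ∈ Finset.univ.filter (fun i : Fin n => (i : ℕ) < k),
          Real.log |lam i|) -
      (1 / (n : ℝ)) * (∑ i : Fin n, Real.log |lam i|) + η := by
  have hk0 : (0 : ℝ) < k := by exact_mod_cast hk
  have hn0 : (0 : ℝ) < n := by exact_mod_cast hk.trans hkn
  have hS : 0 < Sg.det := hSg.det_pos
  have hw0 : 0 ≤ (W * Sg * Wᵀ).det := by
    simpa using (hSg.posSemidef.mul_mul_conjTranspose_same W).det_nonneg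
  have hrhs : 0 < Real.exp (-(2 * η)) * Sg.det ^ (1 / (n : ℝ)) := by positivity
  have hw : 0 < (W * Sg * Wᵀ).det := by
    refine lt_of_le_of_ne hw0 fun h => ?_
    rw [← h, Real.zero_rpow (by positivity)] at hconstraint
    exact absurd hconstraint (not_le.mpr hrhs)
  have hlog := Real.log_le_log hrhs hconstraint
  rw [Real.log_mul (Real.exp_pos _).ne' (Real.rpow_pos_of_pos hS _).ne', Real.log_exp,
    Real.log_rpow hS, Real.log_rpow hw] at hlog
  have ha : 0 < |(W * A * (Wᵀ * (W * Wᵀ)⁻¹)).det| := abs_pos.mpr hAM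
  have hd : 0 < |A.det| := abs_pos.mpr hAdet
  have hdlog : Real.log |A.det| = ∑ i, Real.log |lam i| := by
    rw [hA, abs_det_orthogonal_conj_diagonal lam hV,
      Real.log_prod fun i _ => abs_ne_zero.mpr (hlam i)]
  have halog : Real.log |(W * A * (Wᵀ * (W * Wᵀ)⁻¹)).det| ≤
      ∑ i ∈ Finset.univ.filter (fun i : Fin n => (i : ℕ) < k), Real.log |lam i| := by
    rw [← Real.log_prod fun i _ => abs_ne_zero.mpr (hlam i),
      ← prod_castLE_eq_prod_filter hkn fun i => |lam i|]
    refine Real.log_le_log ha ?_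
    rw [hA]
    exact abs_det_mul_pseudoinverse_le hkn hV hsort hW
  have hmul := mul_le_mul_of_nonneg_left halog (one_div_pos.mpr hk0).le
  rw [deltaJ, Real.log_div (Real.rpow_pos_of_pos ha _).ne' (Real.rpow_pos_of_pos hd _).ne',
    Real.log_div (Real.rpow_pos_of_pos hS _).ne' (Real.rpow_pos_of_pos hw _).ne',
    Real.log_rpow ha, Real.log_rpow hd, Real.log_rpow hS, Real.log_rpow hw, hdlog]
  have half (m x : ℝ) : 1 / (2 * m) * x = 1 / m * x / 2 := by
    rw [one_div, one_div, mul_inv]; ring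
  rw [half, half]
  linarith
end
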